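/- Let n, k ∈ ℕ, let 1 < p ≤ q < ∞ with 0 ≤ 1/p − 1/q ≤ 1/n, let η > 0, let α ∈ ℝ with α ≠ 1, and let R > exp^{k+1}(1). Then there exists a constant C > 0 such that for every u ∈ C_c^∞(B_η∖{0}), ∫_{B_η} |∇u(x)|^p w_{k,α}(|x|)^{p−1} |x|^{1−n} dx ≥ C·|α−1|^{p−1+p/q} · ( ∫_{B_η} |u(x)|^q |x|^{1−n} / ( w_{k,α}(|x|) · (log^k(Rη/|x|))^{(1−α)(1+q/p')} ) dx )^{p/q}. -/

import Mathlib

open Real MeasureTheory Filter Topology Set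

/-- The weight `w_{k,α}(t) = t · (∏_{j=1}^{k-1} log^j(Rη/t)) · (log^k(Rη/t))^α`, where
`log^j` is the `j`-fold iterated logarithm. -/
noncomputable def wlog (k : ℕ) (α R η t : ℝ) : ℝ :=
  t * (∏ j ∈ Finset.Ico 1 k, Real.log^[j] (R * η / t)) * (Real.log^[k] (R * η / t)) ^ α


lemma hasFDerivAt_norm_aux {n : ℕ} {x : EuclideanSpace ℝ (Fin n)} (hx : x ≠ 0) :
    HasFDerivAt (fun y : EuclideanSpace ℝ (Fin n) => ‖y‖) (‖x‖⁻¹ • innerSL ℝ x) x := by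
  have h1 := (hasStrictFDerivAt_norm_sq x).hasFDerivAt.sqrt (by positivity)
  have h2 : (fun y : EuclideanSpace ℝ (Fin n) => √(‖y‖ ^ 2)) = fun y => ‖y‖ := by
    funext y; exact Real.sqrt_sq (norm_nonneg _)
  rw [h2] at h1
  refine h1.congr_fderiv ?_
  rw [Real.sqrt_sq (norm_nonneg _)]
  ext h
  simp
  field_simp

lemma hasFDerivAt_norm_pow_aux {n : ℕ} {x : EuclideanSpace ℝ (Fin n)} (hx : x ≠ 0) (a : ℝ) :
    HasFDerivAt (fun y : EuclideanSpace ℝ (Fin n) => ‖y‖ ^ a)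
      ((a * ‖x‖ ^ (a - 2)) • innerSL ℝ x) x := by
  have hx' : 0 < ‖x‖ := norm_pos_iff.2 hx
  have h1 := (hasFDerivAt_norm_aux hx).rpow_const (p := a) (Or.inl hx'.ne')
  refine h1.congr_fderiv ?_
  rw [smul_smul]
  congr 1
  rw [show a - 2 = (a - 1) - 1 by ring, Real.rpow_sub_one hx'.ne' (a - 1)]
  field_simp

lemma integ_aux {n : ℕ} {h : EuclideanSpace ℝ (Fin n) → ℝ} {δ M : ℝ} (hδ : 0 < δ)
    (hc : ContinuousOn h {y | y ≠ 0}) (hz : ∀ y, ¬(δ ≤ ‖y‖ ∧ ‖y‖ ≤ M) → h y = 0) :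
    Integrable h := by
  set A : Set (EuclideanSpace ℝ (Fin n)) := {y | δ ≤ ‖y‖ ∧ ‖y‖ ≤ M} with hA
  have hcl : IsClosed A := (isClosed_le continuous_const continuous_norm).inter
    (isClosed_le continuous_norm continuous_const)
  have hcpt : IsCompact A := by
    refine (isCompact_closedBall (0 : EuclideanSpace ℝ (Fin n)) M).of_isClosed_subset hcl ?_
    intro y hy; simpa using hy.2
  have h1 : IntegrableOn h A := (hc.mono (by
    intro y hy h0
    have := hy.1
    simp [h0] at this; linarith)).integrableOn_compact hcpt
  rwa [integrableOn_iff_integrable_of_support_subset] at h1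
  intro y hy
  by_contra hcon
  exact hy (hz y hcon)

lemma rpow_interp {x m r : ℝ} (hx : 0 ≤ x) (h1 : 1 ≤ m) (h2 : m ≤ r) : x ^ m ≤ x + x ^ r := by
  rcases le_total x 1 with h | h
  · have : x ^ m ≤ x ^ (1:ℝ) := Real.rpow_le_rpow_of_exponent_ge' hx h zero_le_one h1
    rw [Real.rpow_one] at this
    have := Real.rpow_nonneg hx r; linarith
  · have := Real.rpow_le_rpow_of_exponent_le h h2
    linarith

lemma fderiv_zero_of_annulus {n : ℕ} {G : EuclideanSpace ℝ (Fin n) → ℝ} {δ M : ℝ}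
    (hz : ∀ y, ¬(δ ≤ ‖y‖ ∧ ‖y‖ ≤ M) → G y = 0) :
    ∀ y, ¬(δ ≤ ‖y‖ ∧ ‖y‖ ≤ M) → fderiv ℝ G y = 0 := by
  intro y hy
  have hcl : IsClosed {y : EuclideanSpace ℝ (Fin n) | δ ≤ ‖y‖ ∧ ‖y‖ ≤ M} :=
    (isClosed_le continuous_const continuous_norm).inter
    (isClosed_le continuous_norm continuous_const)
  have h : G =ᶠ[𝓝 y] fun _ => 0 := by
    filter_upwards [hcl.isOpen_compl.mem_nhds hy] with z hz'
    exact hz z hz'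
  rw [h.fderiv_eq]; simp

lemma compactSupport_of_annulus {n : ℕ} {G : EuclideanSpace ℝ (Fin n) → ℝ} {δ M : ℝ}
    (hz : ∀ y, ¬(δ ≤ ‖y‖ ∧ ‖y‖ ≤ M) → G y = 0) : HasCompactSupport G := by
  refine HasCompactSupport.of_support_subset_isCompact
    (isCompact_closedBall (0 : EuclideanSpace ℝ (Fin n)) M) ?_
  intro y hy
  by_contra hcon
  refine hy (hz y fun h => hcon ?_)
  simpa using h.2

/-- one-dimensional sup bound -/
lemma sup_bound_one {G : EuclideanSpace ℝ (Fin 1) → ℝ} (hG : ContDiff ℝ 1 G)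
    (hc : HasCompactSupport G) (x : EuclideanSpace ℝ (Fin 1)) :
    |G x| ≤ ∫ y, ‖fderiv ℝ G y‖ := by
  have hint : Integrable (fun y => ‖fderiv ℝ G y‖) := by
    refine Continuous.integrable_of_hasCompactSupport
      (hG.continuous_fderiv one_ne_zero).norm (hc.fderiv ℝ).norm
  let e : EuclideanSpace ℝ (Fin 1) := EuclideanSpace.single 0 1
  have he : ‖e‖ = 1 := by simp [e]
  let L : ℝ →L[ℝ] EuclideanSpace ℝ (Fin 1) := ContinuousLinearMap.toSpanSingleton ℝ e
  have hL : ∀ t, L t = t • e := fun t => by simp [L]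
  let b : OrthonormalBasis (Fin 1) ℝ ℝ := OrthonormalBasis.singleton (Fin 1) ℝ
  let iso : EuclideanSpace ℝ (Fin 1) ≃ₗᵢ[ℝ] ℝ := b.repr.symm
  have hiso : ∀ t, iso.symm t = t • e := by
    intro t
    ext i
    fin_cases i
    simp [iso, e, b]
    exact OrthonormalBasis.singleton_repr (ι := Fin 1) t 0
  have hmp := iso.symm.measurePreserving
  have hemb : MeasurableEmbedding iso.symm := iso.symm.toHomeomorph.measurableEmbedding
  have hgc : ContDiff ℝ 1 (fun t => G (iso.symm t)) := hG.comp iso.symm.contDiff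
  have hgs : HasCompactSupport (fun t => G (iso.symm t)) :=
    hc.comp_homeomorph iso.symm.toHomeomorph
  have key := HasCompactSupport.enorm_le_lintegral_Ici_deriv hgc hgs (iso x)
  simp only [LinearIsometryEquiv.symm_apply_apply] at key
  have hle : ∀ t, ‖deriv (fun t => G (iso.symm t)) t‖ₑ ≤ ‖fderiv ℝ G (iso.symm t)‖ₑ := by
    intro t
    have hd : HasDerivAt (fun t => G (iso.symm t)) (fderiv ℝ G (iso.symm t) e) t := by
      have h1 : HasFDerivAt G (fderiv ℝ G (iso.symm t)) (iso.symm t) :=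
        ((hG.differentiable one_ne_zero) _).hasFDerivAt
      refine h1.comp_hasDerivAt t ?_
      have : (fun t => iso.symm t) = fun t : ℝ => t • e := funext hiso
      change HasDerivAt (fun t => iso.symm t) e t
      rw [this]
      simpa using (hasDerivAt_id t).smul_const e
    rw [hd.deriv]
    have := (fderiv ℝ G (iso.symm t)).le_opNorm e
    rw [he, mul_one] at this
    exact enorm_le_iff_norm_le.2 this
  have h3 : ‖G x‖ₑ ≤ ∫⁻ y, ‖fderiv ℝ G y‖ₑ := by
    calc ‖G x‖ₑ ≤ _ := key
      _ ≤ ∫⁻ t, ‖fderiv ℝ G (iso.symm t)‖ₑ := by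
        refine (lintegral_mono hle).trans ?_
        exact lintegral_mono' Measure.restrict_le_self le_rfl
      _ = ∫⁻ y, ‖fderiv ℝ G y‖ₑ := hmp.lintegral_comp_emb hemb (fun y => ‖fderiv ℝ G y‖ₑ)
  have hint2 : Integrable (fun y => fderiv ℝ G y) :=
    Continuous.integrable_of_hasCompactSupport
      (hG.continuous_fderiv one_ne_zero) (hc.fderiv ℝ)
  rw [← ofReal_integral_norm_eq_lintegral_enorm hint2, ← ofReal_norm] at h3
  exact (ENNReal.ofReal_le_ofReal_iff (integral_nonneg fun _ => norm_nonneg _)).1 h3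

lemma sobM (n : ℕ) (hn : 1 ≤ n) (m : ℝ) (hm : 1 ≤ m) (hmn : m * (n - 1) ≤ n) :
    ∃ C : ℝ, 0 < C ∧ ∀ (G : EuclideanSpace ℝ (Fin n) → ℝ) (δ M : ℝ), ContDiff ℝ 1 G → 0 < δ →
      (∀ y, ¬(δ ≤ ‖y‖ ∧ ‖y‖ ≤ M) → G y = 0) → ∀ A : ℝ, 0 < A →
      ∫ y, |G y| * ‖y‖ ^ (-1 : ℝ) ≤ A → ∫ y, ‖fderiv ℝ G y‖ ≤ A →
      ∫ y, (|G y| * ‖y‖ ^ ((n : ℝ) - 1)) ^ m * ‖y‖ ^ (-(n : ℝ)) ≤ C * A ^ m := by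
  have npos : ∀ (a : ℝ), ContinuousOn (fun y : EuclideanSpace ℝ (Fin n) => ‖y‖ ^ a) {y | y ≠ 0} := by
    intro a y hy
    exact (continuous_norm.continuousAt.rpow_const (Or.inl (norm_ne_zero_iff.2 hy))).continuousWithinAt
  rcases hn.eq_or_lt with h1 | h1
  · subst h1
    refine ⟨1, one_pos, ?_⟩
    intro G δ M hG hδ hz A hA hA1 hA2
    have hcs := compactSupport_of_annulus hz
    have hsup : ∀ y, |G y| ≤ A := fun y => (sup_bound_one hG hcs y).trans hA2
    have hi : Integrable (fun y => |G y| * ‖y‖ ^ (-1 : ℝ)) :=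
      integ_aux (M := M) hδ (hG.continuous.abs.continuousOn.mul (npos _)) (fun y hy => by simp [hz y hy])
    calc ∫ y, (|G y| * ‖y‖ ^ (((1 : ℕ) : ℝ) - 1)) ^ m * ‖y‖ ^ (-((1 : ℕ) : ℝ))
        ≤ ∫ y, A ^ (m - 1) * (|G y| * ‖y‖ ^ (-1 : ℝ)) := by
          refine integral_mono_of_nonneg (Eventually.of_forall fun y => by dsimp; positivity)
            (hi.const_mul _) (Eventually.of_forall fun y => ?_)
          simp only [Nat.cast_one, sub_self, Real.rpow_zero, mul_one]
          rw [← mul_assoc]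
          gcongr
          rcases (abs_nonneg (G y)).eq_or_lt with h | h
          · rw [← h, Real.zero_rpow (by linarith)]; simp
          · rw [show m = (m - 1) + 1 by ring, Real.rpow_add_one h.ne', show m - 1 + 1 - 1 = m - 1 by ring]
            gcongr
            exact hsup y
      _ = A ^ (m - 1) * ∫ y, (|G y| * ‖y‖ ^ (-1 : ℝ)) := integral_const_mul _ _
      _ ≤ A ^ (m - 1) * A := by gcongr
      _ = 1 * A ^ m := by rw [← Real.rpow_add_one hA.ne']; simp
  · have hn1 : (1 : ℝ) < n := by exact_mod_cast h1
    set r : ℝ := n / (n - 1) with hr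
    have hconj : Real.HolderConjugate (n : ℝ) r := Real.HolderConjugate.conjExponent hn1
    have hmr : m ≤ r := by rw [hr, le_div_iff₀ (by linarith)]; exact hmn
    have hr0 : 0 < r := by linarith
    set K := lintegralPowLePowLIntegralFDerivConst
      (volume : Measure (EuclideanSpace ℝ (Fin n))) r with hK
    refine ⟨1 + K, by positivity, ?_⟩
    intro G δ M hG hδ hz A hA hA1 hA2
    have hcs := compactSupport_of_annulus hz
    have hi : Integrable (fun y => |G y| * ‖y‖ ^ (-1 : ℝ)) :=
      integ_aux (M := M) hδ (hG.continuous.abs.continuousOn.mul (npos _)) (fun y hy => by simp [hz y hy])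
    have hi2 : Integrable (fun y => |G y| ^ r) :=
      integ_aux (M := M) hδ (hG.continuous.abs.rpow_const fun _ => Or.inr hr0.le).continuousOn
        (fun y hy => by simp [hz y hy, hr0.ne'])
    have hS : ∫ y, |G y| ^ r ≤ K * A ^ r := by
      have key := lintegral_pow_le_pow_lintegral_fderiv
        (volume : Measure (EuclideanSpace ℝ (Fin n))) hG hcs (p := r) (by simpa using hconj)
      have hint2 : Integrable (fun y => fderiv ℝ G y) :=
        Continuous.integrable_of_hasCompactSupport
          (hG.continuous_fderiv one_ne_zero) (hcs.fderiv ℝ)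
      rw [← ofReal_integral_norm_eq_lintegral_enorm hint2] at key
      have e1 : ∫⁻ y, ‖G y‖ₑ ^ r = ENNReal.ofReal (∫ y, |G y| ^ r) := by
        rw [ofReal_integral_eq_lintegral_ofReal hi2 (Eventually.of_forall fun y => by dsimp; positivity)]
        congr 1; funext y
        rw [← ofReal_norm, ENNReal.ofReal_rpow_of_nonneg (norm_nonneg _) hr0.le, Real.norm_eq_abs]
      rw [e1, ENNReal.ofReal_rpow_of_nonneg (integral_nonneg fun _ => norm_nonneg _) hr0.le,
        ← ENNReal.ofReal_coe_nnreal, ← ENNReal.ofReal_mul (by positivity)] at key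
      have key2 := (ENNReal.ofReal_le_ofReal_iff (by
        have : 0 ≤ ∫ y, ‖fderiv ℝ G y‖ := integral_nonneg fun _ => norm_nonneg _
        positivity)).1 key
      refine key2.trans ?_
      gcongr
    have hpt : ∀ y, (|G y| * ‖y‖ ^ ((n : ℝ) - 1)) ^ m * ‖y‖ ^ (-(n : ℝ)) ≤
        A ^ m * (A⁻¹ * (|G y| * ‖y‖ ^ (-1 : ℝ)) + (A ^ r)⁻¹ * |G y| ^ r) := by
      intro y
      by_cases hy : y = 0
      · have : G y = 0 := hz y (by rw [hy]; simp; intro h; linarith)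
        simp [this, hr0.ne', Real.zero_rpow (show m ≠ 0 by linarith)]
      have hy' : 0 < ‖y‖ := norm_pos_iff.2 hy
      set F := |G y| * ‖y‖ ^ ((n : ℝ) - 1) with hF
      have hF0 : 0 ≤ F := by positivity
      have h := rpow_interp (x := F / A) (by positivity) hm hmr
      rw [Real.div_rpow hF0 hA.le, Real.div_rpow hF0 hA.le, div_le_iff₀ (by positivity)] at h
      have e1 : F * ‖y‖ ^ (-(n:ℝ)) = |G y| * ‖y‖ ^ (-1 : ℝ) := by
        rw [hF, mul_assoc, ← Real.rpow_add hy']; ring_nf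
      have e2 : F ^ r * ‖y‖ ^ (-(n:ℝ)) = |G y| ^ r := by
        rw [hF, Real.mul_rpow (abs_nonneg _) (by positivity), ← Real.rpow_mul hy'.le, mul_assoc,
          ← Real.rpow_add hy']
        have : ((n:ℝ) - 1) * r + -(n:ℝ) = 0 := by
          rw [hr]; have : (n:ℝ) - 1 ≠ 0 := by linarith
          field_simp; ring
        rw [this]; simp
      calc F ^ m * ‖y‖ ^ (-(n : ℝ)) ≤ ((F / A + F ^ r / A ^ r) * A ^ m) * ‖y‖ ^ (-(n : ℝ)) := by gcongr
        _ = A ^ m * (A⁻¹ * (F * ‖y‖ ^ (-(n:ℝ))) + (A ^ r)⁻¹ * (F ^ r * ‖y‖ ^ (-(n:ℝ)))) := by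
          field_simp
        _ = _ := by rw [e1, e2]
    calc ∫ y, (|G y| * ‖y‖ ^ ((n : ℝ) - 1)) ^ m * ‖y‖ ^ (-(n : ℝ))
        ≤ ∫ y, A ^ m * (A⁻¹ * (|G y| * ‖y‖ ^ (-1 : ℝ)) + (A ^ r)⁻¹ * |G y| ^ r) :=
          integral_mono_of_nonneg (Eventually.of_forall fun y => by dsimp; positivity)
            (((hi.const_mul _).add (hi2.const_mul _)).const_mul _) (Eventually.of_forall hpt)
      _ = A ^ m * (A⁻¹ * (∫ y, |G y| * ‖y‖ ^ (-1 : ℝ)) + (A ^ r)⁻¹ * ∫ y, |G y| ^ r) := by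
          rw [integral_const_mul, integral_add (hi.const_mul _) (hi2.const_mul _),
            integral_const_mul, integral_const_mul]
      _ ≤ A ^ m * (A⁻¹ * A + (A ^ r)⁻¹ * (K * A ^ r)) := by gcongr
      _ = (1 + K) * A ^ m := by
          have : A ^ r ≠ 0 := by positivity
          field_simp


lemma cont_aux {n : ℕ} {h : EuclideanSpace ℝ (Fin n) → ℝ} {δ M : ℝ} (hδ : 0 < δ)
    (hc : ContinuousOn h {y | y ≠ 0}) (hz : ∀ y, ¬(δ ≤ ‖y‖ ∧ ‖y‖ ≤ M) → h y = 0) :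
    Continuous h := by
  rw [continuous_iff_continuousAt]
  intro y
  by_cases hy : y = 0
  · have : h =ᶠ[𝓝 y] fun _ => 0 := by
      filter_upwards [Metric.ball_mem_nhds y hδ] with z hz'
      refine hz z fun h => ?_
      rw [hy] at hz'
      have : ‖z‖ < δ := by simpa using hz'
      linarith [h.1]
    exact continuousAt_const.congr this.symm
  · exact hc.continuousAt (isOpen_ne.mem_nhds hy)

lemma npos_aux {n : ℕ} (a : ℝ) :
    ContinuousOn (fun y : EuclideanSpace ℝ (Fin n) => ‖y‖ ^ a) {y | y ≠ 0} := by
  intro y hy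
  exact (continuous_norm.continuousAt.rpow_const
    (Or.inl (norm_ne_zero_iff.2 hy))).continuousWithinAt

lemma not_annulus_zero {n : ℕ} {δ M : ℝ} (hδ : 0 < δ) :
    ¬(δ ≤ ‖(0 : EuclideanSpace ℝ (Fin n))‖ ∧ ‖(0 : EuclideanSpace ℝ (Fin n))‖ ≤ M) := by
  simp only [norm_zero]; intro h; linarith [h.1]

lemma div_aux {n : ℕ} {H : EuclideanSpace ℝ (Fin n) → ℝ} (hH : ContDiff ℝ 1 H)
    (hc : HasCompactSupport H) :
    ∫ y, fderiv ℝ H y y = -(n : ℝ) * ∫ y, H y := by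
  have hcd := hH.continuous_fderiv one_ne_zero
  have hci : ∀ i : Fin n, Continuous (fun y : EuclideanSpace ℝ (Fin n) => y i) := fun i => by
    fun_prop
  have hI : ∀ i : Fin n, Integrable
      (fun y : EuclideanSpace ℝ (Fin n) => y i * fderiv ℝ H y (EuclideanSpace.single i 1)) := by
    intro i
    refine Continuous.integrable_of_hasCompactSupport
      ((hci i).mul (hcd.clm_apply continuous_const)) ?_
    refine HasCompactSupport.mul_left ?_
    exact (hc.fderiv ℝ).comp_left (g := fun L : EuclideanSpace ℝ (Fin n) →L[ℝ] ℝ => L (EuclideanSpace.single i 1)) (by simp)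
  have hHi : Integrable H := hH.continuous.integrable_of_hasCompactSupport hc
  have h1 : ∀ y, fderiv ℝ H y y = ∑ i, y i * fderiv ℝ H y (EuclideanSpace.single i 1) := by
    intro y
    have hy : y = ∑ i, y i • EuclideanSpace.single i (1 : ℝ) := by
      have := (EuclideanSpace.basisFun (Fin n) ℝ).sum_repr y
      simpa using this.symm
    conv_lhs => rw [hy]
    rw [map_sum]
    simp only [← hy, map_smul, smul_eq_mul]
  have hd : ∀ i : Fin n, ∀ y, HasFDerivAt (fun y : EuclideanSpace ℝ (Fin n) => y i)
      (EuclideanSpace.proj i : EuclideanSpace ℝ (Fin n) →L[ℝ] ℝ) y :=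
    fun i y => (EuclideanSpace.proj i : EuclideanSpace ℝ (Fin n) →L[ℝ] ℝ).hasFDerivAt
  have h2 : ∀ i : Fin n, ∫ y : EuclideanSpace ℝ (Fin n),
      y i * fderiv ℝ H y (EuclideanSpace.single i 1) = - ∫ y, H y := by
    intro i
    have e : ∀ y : EuclideanSpace ℝ (Fin n),
        fderiv ℝ (fun y : EuclideanSpace ℝ (Fin n) => y i) y (EuclideanSpace.single i 1) = 1 := by
      intro y; rw [(hd i y).fderiv]; simp
    rw [integral_mul_fderiv_eq_neg_fderiv_mul_of_integrable]
    · simp only [e, one_mul]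
    · simpa only [e, one_mul] using hHi
    · exact hI i
    · exact ((hci i).mul hH.continuous).integrable_of_hasCompactSupport hc.mul_left
    · exact fun y _ => (hd i y).differentiableAt
    · exact fun y _ => (hH.differentiable one_ne_zero) y
  simp_rw [h1]
  rw [integral_finsetSum _ (fun i _ => hI i)]
  simp [h2]

section weighted

variable {n : ℕ} {v : EuclideanSpace ℝ (Fin n) → ℝ} {δ M γ : ℝ}

lemma G_zero (hz : ∀ y, ¬(δ ≤ ‖y‖ ∧ ‖y‖ ≤ M) → v y = 0) (hγ : 1 < γ) (κ : ℝ) :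
    ∀ y, ¬(δ ≤ ‖y‖ ∧ ‖y‖ ≤ M) → ‖v y‖ ^ γ * ‖y‖ ^ κ = 0 := by
  intro y hy; rw [hz y hy, norm_zero, Real.zero_rpow (by linarith), zero_mul]

lemma G_hasFDerivAt (hv : ContDiff ℝ 1 v) (hγ : 1 < γ) (κ : ℝ)
    {y : EuclideanSpace ℝ (Fin n)} (hy : y ≠ 0) :
    HasFDerivAt (fun y => ‖v y‖ ^ γ * ‖y‖ ^ κ)
      ((‖v y‖ ^ γ) • ((κ * ‖y‖ ^ (κ - 2)) • innerSL ℝ y) +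
        (‖y‖ ^ κ) • fderiv ℝ (fun y => ‖v y‖ ^ γ) y) y :=
  (((hv.norm_rpow hγ).differentiable one_ne_zero) y).hasFDerivAt.mul
    (hasFDerivAt_norm_pow_aux hy κ)

lemma G_contDiff (hv : ContDiff ℝ 1 v) (hδ : 0 < δ)
    (hz : ∀ y, ¬(δ ≤ ‖y‖ ∧ ‖y‖ ≤ M) → v y = 0) (hγ : 1 < γ) (κ : ℝ) :
    ContDiff ℝ 1 (fun y => ‖v y‖ ^ γ * ‖y‖ ^ κ) := by
  rw [contDiff_iff_contDiffAt]
  intro y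
  by_cases hy : y = 0
  · have : (fun y => ‖v y‖ ^ γ * ‖y‖ ^ κ) =ᶠ[𝓝 y] fun _ => 0 := by
      filter_upwards [Metric.ball_mem_nhds y hδ] with z hz'
      refine G_zero hz hγ κ z fun h => ?_
      rw [hy] at hz'
      have : ‖z‖ < δ := by simpa using hz'
      linarith [h.1]
    exact contDiffAt_const.congr_of_eventuallyEq this
  · refine (hv.norm_rpow hγ).contDiffAt.mul ?_
    exact (contDiffAt_norm ℝ hy).rpow_const_of_ne (norm_ne_zero_iff.2 hy)

lemma G_grad (hv : ContDiff ℝ 1 v) (hδ : 0 < δ)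
    (hz : ∀ y, ¬(δ ≤ ‖y‖ ∧ ‖y‖ ≤ M) → v y = 0) (hγ : 1 < γ) (κ : ℝ)
    (y : EuclideanSpace ℝ (Fin n)) :
    ‖fderiv ℝ (fun y => ‖v y‖ ^ γ * ‖y‖ ^ κ) y‖ ≤
      γ * (‖v y‖ ^ (γ - 1) * ‖fderiv ℝ v y‖ * ‖y‖ ^ κ) + |κ| * (‖v y‖ ^ γ * ‖y‖ ^ (κ - 1)) := by
  by_cases hy : y = 0
  · rw [fderiv_zero_of_annulus (G_zero hz hγ κ) y (hy ▸ not_annulus_zero hδ), norm_zero]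
    positivity
  have hy' : 0 < ‖y‖ := norm_pos_iff.2 hy
  rw [(G_hasFDerivAt hv hγ κ hy).fderiv]
  refine (norm_add_le _ _).trans ?_
  rw [add_comm]
  have h1 := norm_fderiv_norm_rpow_le (hv.differentiable one_ne_zero) hγ (x := y)
  refine add_le_add ?_ (le_of_eq ?_)
  · rw [norm_smul, Real.norm_of_nonneg (by positivity)]
    calc ‖y‖ ^ κ * _ ≤ ‖y‖ ^ κ * (γ * ‖v y‖ ^ (γ - 1) * ‖fderiv ℝ v y‖) := by gcongr
      _ = _ := by ring
  · rw [norm_smul, norm_smul, innerSL_apply_norm, Real.norm_of_nonneg (by positivity), norm_mul,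
      Real.norm_eq_abs κ, Real.norm_of_nonneg (by positivity : 0 ≤ ‖y‖ ^ (κ - 2)),
      show κ - 1 = (κ - 2) + 1 by ring, Real.rpow_add_one hy'.ne']
    ring

lemma G_euler (hv : ContDiff ℝ 1 v) (hδ : 0 < δ)
    (hz : ∀ y, ¬(δ ≤ ‖y‖ ∧ ‖y‖ ≤ M) → v y = 0) (hγ : 1 < γ) (κ : ℝ)
    (y : EuclideanSpace ℝ (Fin n)) :
    |fderiv ℝ (fun y => ‖v y‖ ^ γ * ‖y‖ ^ κ) y y - κ * (‖v y‖ ^ γ * ‖y‖ ^ κ)| ≤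
      γ * (‖v y‖ ^ (γ - 1) * ‖fderiv ℝ v y‖ * ‖y‖ ^ (κ + 1)) := by
  by_cases hy : y = 0
  · rw [fderiv_zero_of_annulus (G_zero hz hγ κ) y (hy ▸ not_annulus_zero hδ),
      G_zero hz hγ κ y (hy ▸ not_annulus_zero hδ)]
    simp
    positivity
  have hy' : 0 < ‖y‖ := norm_pos_iff.2 hy
  rw [(G_hasFDerivAt hv hγ κ hy).fderiv]
  have h1 := norm_fderiv_norm_rpow_le (hv.differentiable one_ne_zero) hγ (x := y)
  have h2 := (fderiv ℝ (fun y => ‖v y‖ ^ γ) y).le_opNorm y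
  have e : ((‖v y‖ ^ γ) • ((κ * ‖y‖ ^ (κ - 2)) • innerSL ℝ y) +
        (‖y‖ ^ κ) • fderiv ℝ (fun y => ‖v y‖ ^ γ) y) y - κ * (‖v y‖ ^ γ * ‖y‖ ^ κ) =
      ‖y‖ ^ κ * fderiv ℝ (fun y => ‖v y‖ ^ γ) y y := by
    have : ‖y‖ ^ κ = ‖y‖ ^ (κ - 2) * ‖y‖ ^ 2 := by
      rw [← Real.rpow_natCast ‖y‖ 2, ← Real.rpow_add hy']; norm_num
    simp only [add_apply, smul_apply, smul_eq_mul,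
      innerSL_apply_apply, real_inner_self_eq_norm_sq]
    rw [this]; ring
  rw [e, abs_mul, abs_of_nonneg (by positivity : 0 ≤ ‖y‖ ^ κ), Real.rpow_add_one hy'.ne',
    ← Real.norm_eq_abs]
  calc ‖y‖ ^ κ * _ ≤ ‖y‖ ^ κ * ((γ * ‖v y‖ ^ (γ - 1) * ‖fderiv ℝ v y‖) * ‖y‖) := by
        gcongr; exact h2.trans (by gcongr)
    _ = _ := by ring

lemma N_integrable (hv : ContDiff ℝ 1 v) (hδ : 0 < δ)
    (hz : ∀ y, ¬(δ ≤ ‖y‖ ∧ ‖y‖ ≤ M) → v y = 0) (hγ : 1 < γ) (κ : ℝ) :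
    Integrable (fun y => ‖v y‖ ^ (γ - 1) * ‖fderiv ℝ v y‖ * ‖y‖ ^ κ) := by
  refine integ_aux (M := M) hδ (ContinuousOn.mul ?_ (npos_aux κ)) ?_
  · exact ((hv.continuous.norm.rpow_const fun _ => Or.inr (by linarith)).mul
      (hv.continuous_fderiv one_ne_zero).norm).continuousOn
  · intro y hy; rw [hz y hy, norm_zero, Real.zero_rpow (by linarith)]; simp

lemma V_integrable (hv : ContDiff ℝ 1 v) (hδ : 0 < δ)
    (hz : ∀ y, ¬(δ ≤ ‖y‖ ∧ ‖y‖ ≤ M) → v y = 0) (hγ : 1 < γ) (κ : ℝ) :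
    Integrable (fun y => ‖v y‖ ^ γ * ‖y‖ ^ κ) := by
  refine integ_aux (M := M) hδ (ContinuousOn.mul ?_ (npos_aux κ)) (G_zero hz hγ κ)
  exact (hv.continuous.norm.rpow_const fun _ => Or.inr (by linarith)).continuousOn

lemma hardy_aux (hv : ContDiff ℝ 1 v) (hδ : 0 < δ)
    (hz : ∀ y, ¬(δ ≤ ‖y‖ ∧ ‖y‖ ≤ M) → v y = 0) (hγ : 1 < γ) (b : ℝ) :
    |b| * ∫ y, ‖v y‖ ^ γ * ‖y‖ ^ (b - n) ≤
      γ * ∫ y, ‖v y‖ ^ (γ - 1) * ‖fderiv ℝ v y‖ * ‖y‖ ^ (b - n + 1) := by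
  set κ := b - n with hκ
  have hG := G_contDiff hv hδ hz hγ κ
  have hGc := compactSupport_of_annulus (G_zero hz hγ κ)
  have hdiv := div_aux hG hGc
  have hVi := V_integrable hv hδ hz hγ κ
  have hDi : Integrable (fun y => fderiv ℝ (fun y => ‖v y‖ ^ γ * ‖y‖ ^ κ) y y) := by
    refine Continuous.integrable_of_hasCompactSupport
      ((hG.continuous_fderiv one_ne_zero).clm_apply continuous_id) ?_
    refine compactSupport_of_annulus (δ := δ) (M := M) fun y hy => ?_
    rw [fderiv_zero_of_annulus (G_zero hz hγ κ) y hy]; simp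
  have h1 : ∫ y, (fderiv ℝ (fun y => ‖v y‖ ^ γ * ‖y‖ ^ κ) y y - κ * (‖v y‖ ^ γ * ‖y‖ ^ κ))
      = -b * ∫ y, ‖v y‖ ^ γ * ‖y‖ ^ κ := by
    rw [integral_sub hDi (hVi.const_mul _), hdiv, integral_const_mul, hκ]; ring
  have h2 : |∫ y, (fderiv ℝ (fun y => ‖v y‖ ^ γ * ‖y‖ ^ κ) y y - κ * (‖v y‖ ^ γ * ‖y‖ ^ κ))|
      ≤ ∫ y, γ * (‖v y‖ ^ (γ - 1) * ‖fderiv ℝ v y‖ * ‖y‖ ^ (κ + 1)) := by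
    refine (abs_integral_le_integral_abs).trans ?_
    exact integral_mono (hDi.sub (hVi.const_mul _)).abs
      ((N_integrable hv hδ hz hγ (κ + 1)).const_mul _) (G_euler hv hδ hz hγ κ)
  rw [h1, abs_mul, abs_neg, integral_const_mul] at h2
  rwa [abs_of_nonneg (integral_nonneg fun y => by positivity : 0 ≤ ∫ y, ‖v y‖ ^ γ * ‖y‖ ^ κ)] at h2

end weighted

/-- power-weighted CKN inequality away from the origin. -/
lemma ckn_aux (n : ℕ) (hn : 1 ≤ n) (p q : ℝ) (hp : 1 < p) (hpq : p ≤ q)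
    (h2 : 1 / p - 1 / q ≤ 1 / (n : ℝ)) (β : ℝ) (hβ : β ≠ 0) :
    ∃ C : ℝ, 0 < C ∧ ∀ (v : EuclideanSpace ℝ (Fin n) → ℝ) (δ M : ℝ), ContDiff ℝ 1 v → 0 < δ →
      (∀ y, ¬(δ ≤ ‖y‖ ∧ ‖y‖ ≤ M) → v y = 0) →
      (∫ y, ‖v y‖ ^ q * ‖y‖ ^ (β * q - n)) ^ (p / q) ≤
        C * ∫ y, ‖fderiv ℝ v y‖ ^ p * ‖y‖ ^ ((β + 1) * p - n) := by
  have hp0 : 0 < p := by linarith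
  have hq0 : 0 < q := by linarith
  have hn0 : (0:ℝ) < n := by exact_mod_cast hn
  set p' := p / (p - 1) with hp'
  have hconj : p.HolderConjugate p' := Real.HolderConjugate.conjExponent hp
  have hp'0 : 0 < p' := hconj.symm.pos
  have hinv : 1 / p + 1 / p' = 1 := by simpa using hconj.inv_add_inv_eq_one
  set γ := 1 + q / p' with hγd
  have hγ : 1 < γ := by have : 0 < q / p' := by positivity
                        linarith
  have hγ0 : 0 < γ := by linarith
  have hγ2 : γ = 1 + q - q / p := by
    have : q / p' = q * (1 - 1 / p) := by
      rw [show 1 - 1 / p = 1 / p' by linarith]; ring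
    rw [hγd, this]; ring
  set m := q / γ with hm
  have hm1 : 1 ≤ m := by
    rw [hm, le_div_iff₀ hγ0, hγ2]
    have : 1 ≤ q / p := by rwa [le_div_iff₀ hp0, one_mul]
    linarith
  have hmn : m * (n - 1) ≤ n := by
    rw [hm, div_mul_eq_mul_div, div_le_iff₀ hγ0, hγ2]
    have := mul_le_mul_of_nonneg_left h2 (by positivity : 0 ≤ q * n)
    have e1 : q * n * (1 / p - 1 / q) = n * (q / p) - n := by field_simp
    have e2 : q * n * (1 / n) = q := by field_simp
    rw [e1, e2] at this
    linarith
  have hγm : γ * m = q := by rw [hm]; field_simp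
  obtain ⟨C, hC, hsob⟩ := sobM n hn m hm1 hmn
  set κ := β * γ - n + 1 with hκ
  set c := γ + |κ| / |β| + 1 / |β| with hc
  have hβ' : 0 < |β| := abs_pos.2 hβ
  have hc0 : 0 < c := by positivity
  refine ⟨(C * c ^ m) ^ (γ * p / q), by positivity, ?_⟩
  intro v δ M hv hδ hz
  set a := ∫ y, ‖v y‖ ^ q * ‖y‖ ^ (β * q - n) with ha
  set D := ∫ y, ‖fderiv ℝ v y‖ ^ p * ‖y‖ ^ ((β + 1) * p - n) with hD
  have ha0 : 0 ≤ a := integral_nonneg fun y => by positivity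
  have hD0 : 0 ≤ D := integral_nonneg fun y => by positivity
  set N := ∫ y, ‖v y‖ ^ (γ - 1) * ‖fderiv ℝ v y‖ * ‖y‖ ^ κ with hN
  have hN0 : 0 ≤ N := integral_nonneg fun y => by positivity
  have hardy : ∫ y, ‖v y‖ ^ γ * ‖y‖ ^ (κ - 1) ≤ N / |β| := by
    have h := hardy_aux hv hδ hz hγ (β * γ)
    rw [← hκ, ← hN, abs_mul, abs_of_pos hγ0] at h
    rw [show κ - 1 = β * γ - n by rw [hκ]; ring, le_div_iff₀ hβ']
    have := le_of_mul_le_mul_left (a := γ) (by linarith : γ * (|β| * _) ≤ γ * N) hγ0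
    linarith
  have hgrad : ∫ y, ‖fderiv ℝ (fun y => ‖v y‖ ^ γ * ‖y‖ ^ κ) y‖ ≤ γ * N + |κ| * (N / |β|) := by
    have i1 := N_integrable hv hδ hz hγ κ
    have i2 := V_integrable hv hδ hz hγ (κ - 1)
    calc _ ≤ ∫ y, (γ * (‖v y‖ ^ (γ - 1) * ‖fderiv ℝ v y‖ * ‖y‖ ^ κ) +
          |κ| * (‖v y‖ ^ γ * ‖y‖ ^ (κ - 1))) :=
          integral_mono_of_nonneg (Eventually.of_forall fun y => norm_nonneg _)
            ((i1.const_mul _).add (i2.const_mul _)) (Eventually.of_forall (G_grad hv hδ hz hγ κ))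
      _ = γ * N + |κ| * ∫ y, ‖v y‖ ^ γ * ‖y‖ ^ (κ - 1) := by
          rw [integral_add (i1.const_mul _) (i2.const_mul _), integral_const_mul,
            integral_const_mul]
      _ ≤ _ := by gcongr
  -- Hölder
  have hholder : N ≤ D ^ (1 / p) * a ^ (1 / p') := by
    set f : EuclideanSpace ℝ (Fin n) → ℝ := fun y => ‖fderiv ℝ v y‖ * ‖y‖ ^ (β + 1 - n / p) with hf
    set g : EuclideanSpace ℝ (Fin n) → ℝ :=
      fun y => ‖v y‖ ^ (γ - 1) * ‖y‖ ^ (β * (γ - 1) - n / p') with hg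
    have hfz : ∀ y, ¬(δ ≤ ‖y‖ ∧ ‖y‖ ≤ M) → f y = 0 := fun y hy => by
      simp [hf, fderiv_zero_of_annulus hz y hy]
    have hgz : ∀ y, ¬(δ ≤ ‖y‖ ∧ ‖y‖ ≤ M) → g y = 0 := fun y hy => by
      simp [hg, hz y hy, Real.zero_rpow (show γ - 1 ≠ 0 by linarith)]
    have hfc : Continuous f := cont_aux hδ
      (((hv.continuous_fderiv one_ne_zero).norm).continuousOn.mul (npos_aux _)) hfz
    have hgc : Continuous g := cont_aux hδ
      ((hv.continuous.norm.rpow_const fun _ => Or.inr (by linarith)).continuousOn.mul (npos_aux _)) hgz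
    have key := integral_mul_le_Lp_mul_Lq_of_nonneg (μ := volume) hconj
      (f := f) (g := g)
      (Eventually.of_forall fun y => by simp only [hf, Pi.zero_apply]; positivity)
      (Eventually.of_forall fun y => by simp only [hg, Pi.zero_apply]; positivity)
      (hfc.memLp_of_hasCompactSupport (compactSupport_of_annulus hfz))
      (hgc.memLp_of_hasCompactSupport (compactSupport_of_annulus hgz))
    have e1 : ∀ y, f y * g y = ‖v y‖ ^ (γ - 1) * ‖fderiv ℝ v y‖ * ‖y‖ ^ κ := by
      intro y
      by_cases hy : y = 0
      · have hy0 := hy ▸ not_annulus_zero (n := n) (M := M) hδ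
        rw [hfz y hy0, fderiv_zero_of_annulus hz y hy0]; simp
      have hy' : 0 < ‖y‖ := norm_pos_iff.2 hy
      have : ‖y‖ ^ κ = ‖y‖ ^ (β + 1 - n / p) * ‖y‖ ^ (β * (γ - 1) - n / p') := by
        rw [← Real.rpow_add hy']; congr 1; rw [hκ]
        have : (n:ℝ) = n / p + n / p' := by
          calc (n:ℝ) = n * (1 / p + 1 / p') := by rw [hinv]; ring
            _ = _ := by ring
        linarith
      rw [this, hf, hg]; ring
    have e2 : ∀ y, f y ^ p = ‖fderiv ℝ v y‖ ^ p * ‖y‖ ^ ((β + 1) * p - n) := by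
      intro y
      simp only [hf]
      rw [Real.mul_rpow (norm_nonneg _) (by positivity), ← Real.rpow_mul (norm_nonneg _)]
      congr 2; field_simp
    have e3 : ∀ y, g y ^ p' = ‖v y‖ ^ q * ‖y‖ ^ (β * q - n) := by
      intro y
      simp only [hg]
      rw [Real.mul_rpow (by positivity) (by positivity), ← Real.rpow_mul (norm_nonneg _),
        ← Real.rpow_mul (norm_nonneg _)]
      have : (γ - 1) * p' = q := by rw [hγd]; field_simp; ring
      rw [this, sub_mul, mul_assoc, this]
      congr 2; field_simp
    simpa only [e1, e2, e3] using key
  set T := D ^ (1 / p) * a ^ (1 / p') with hT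
  have hT0 : 0 ≤ T := by positivity
  have step : ∀ ε : ℝ, 0 < ε → a ≤ C * (c * (T + ε)) ^ m := by
    intro ε hε
    have h := hsob (fun y => ‖v y‖ ^ γ * ‖y‖ ^ κ) δ M (G_contDiff hv hδ hz hγ κ) hδ (G_zero hz hγ κ)
      (c * (T + ε)) (by positivity) ?_ ?_
    · convert h using 1
      rw [ha]; congr 1; funext y
      by_cases hy : y = 0
      · have hy0 := hy ▸ not_annulus_zero (n := n) (M := M) hδ
        simp [hz y hy0, Real.zero_rpow hq0.ne', Real.zero_rpow hγ0.ne', Real.zero_rpow (show m ≠ 0 by linarith)]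
      have hy' : 0 < ‖y‖ := norm_pos_iff.2 hy
      rw [abs_of_nonneg (by positivity), mul_assoc (‖v y‖ ^ γ), ← Real.rpow_add hy',
        Real.mul_rpow (by positivity) (by positivity), ← Real.rpow_mul (norm_nonneg _),
        ← Real.rpow_mul (norm_nonneg _), hγm, mul_assoc, ← Real.rpow_add hy']
      congr 2
      have : (κ + (n - 1)) * m = β * q := by rw [hκ, ← hγm]; ring
      rw [this]; ring
    · have e : ∀ y : EuclideanSpace ℝ (Fin n), |‖v y‖ ^ γ * ‖y‖ ^ κ| * ‖y‖ ^ (-1 : ℝ) = ‖v y‖ ^ γ * ‖y‖ ^ (κ - 1) := by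
        intro y
        by_cases hy : y = 0
        · have hy0 := hy ▸ not_annulus_zero (n := n) (M := M) hδ
          simp [hz y hy0, Real.zero_rpow hγ0.ne']
        have hy' : 0 < ‖y‖ := norm_pos_iff.2 hy
        rw [abs_of_nonneg (by positivity), mul_assoc, ← Real.rpow_add hy']; ring_nf
      simp only [e]
      refine hardy.trans ?_
      calc N / |β| = 1 / |β| * N := by ring
        _ ≤ c * (T + ε) := by
          gcongr
          · rw [hc]; have : 0 ≤ γ + |κ| / |β| := by positivity
            linarith
          · linarith
    · refine hgrad.trans ?_
      calc γ * N + |κ| * (N / |β|) = (γ + |κ| / |β|) * N := by ring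
        _ ≤ c * (T + ε) := by
          gcongr
          · rw [hc]; have : 0 ≤ 1 / |β| := by positivity
            linarith
          · linarith
  have step2 : a ≤ C * (c * T) ^ m := by
    have ht : Tendsto (fun ε : ℝ => C * (c * (T + ε)) ^ m) (𝓝[>] 0) (𝓝 (C * (c * (T + 0)) ^ m)) := by
      have : Continuous (fun ε : ℝ => C * (c * (T + ε)) ^ m) :=
        continuous_const.mul ((by fun_prop : Continuous (fun ε : ℝ => c * (T + ε))).rpow_const
          fun _ => Or.inr (by linarith))
      exact (this.tendsto 0).mono_left nhdsWithin_le_nhds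
    rw [add_zero] at ht
    refine ge_of_tendsto ht ?_
    filter_upwards [self_mem_nhdsWithin] with ε hε using step ε hε
  rcases ha0.eq_or_lt with h0 | h0
  · rw [← h0, Real.zero_rpow (by positivity)]; positivity
  have hexp : 1 / γ + m / p' = 1 := by
    rw [hm]
    have : γ * p' = p' + q := by rw [hγd]; field_simp
    field_simp
    linarith
  have step3 : a ^ (1 / γ) ≤ (C * c ^ m) * D ^ (m / p) := by
    have e1 : a = a ^ (1 / γ) * a ^ (m / p') := by rw [← Real.rpow_add h0, hexp, Real.rpow_one]
    have e2 : C * (c * T) ^ m = (C * c ^ m) * D ^ (m / p) * a ^ (m / p') := by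
      rw [hT, Real.mul_rpow hc0.le (by positivity), Real.mul_rpow (by positivity) (by positivity),
        ← Real.rpow_mul hD0, ← Real.rpow_mul ha0, one_div_mul_eq_div, one_div_mul_eq_div]; ring
    rw [e2] at step2
    refine le_of_mul_le_mul_right (a := a ^ (m / p')) ?_ (by positivity)
    rw [← e1]; exact step2
  have step4 := Real.rpow_le_rpow (by positivity) step3 (by positivity : 0 ≤ γ * p / q)
  rw [← Real.rpow_mul ha0, Real.mul_rpow (by positivity) (by positivity), ← Real.rpow_mul hD0] at step4
  have e1 : 1 / γ * (γ * p / q) = p / q := by field_simp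
  have e2 : m / p * (γ * p / q) = 1 := by
    rw [← hγm]; have : 0 < m := by linarith
    field_simp
  rwa [e1, e2, Real.rpow_one] at step4

/-- product of iterated exponentials -/
noncomputable def Pexp (k : ℕ) (s : ℝ) : ℝ := ∏ j ∈ Finset.Ico 1 k, Real.exp^[k - j] s

lemma log_iter_exp_iter {j k : ℕ} (hjk : j ≤ k) (s : ℝ) :
    Real.log^[j] (Real.exp^[k] s) = Real.exp^[k - j] s := by
  obtain ⟨i, rfl⟩ := Nat.exists_eq_add_of_le hjk
  rw [Function.iterate_add_apply, (Function.LeftInverse.iterate (fun x => Real.log_exp x) j) _]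
  simp

lemma exp_iter_strictMono (k : ℕ) : StrictMono (Real.exp^[k]) := Real.exp_strictMono.iterate k

lemma le_exp_iter (k : ℕ) (s : ℝ) : s ≤ Real.exp^[k] s := by
  induction k with
  | zero => simp
  | succ k ih =>
    rw [Function.iterate_succ_apply']
    linarith [Real.add_one_le_exp (Real.exp^[k] s)]

lemma exp_iter_contDiff (k : ℕ) : ContDiff ℝ 1 (Real.exp^[k]) := by
  induction k with
  | zero => exact contDiff_id
  | succ k ih => rw [Function.iterate_succ']; exact Real.contDiff_exp.comp ih

lemma exp_iter_pos {k : ℕ} (hk : 1 ≤ k) (s : ℝ) : 0 < Real.exp^[k] s := by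
  obtain ⟨i, rfl⟩ := Nat.exists_eq_add_of_le' hk
  rw [Function.iterate_succ_apply']; exact Real.exp_pos _

lemma Pexp_pos (k : ℕ) (s : ℝ) : 0 < Pexp k s := by
  refine Finset.prod_pos fun j hj => exp_iter_pos ?_ s
  rw [Finset.mem_Ico] at hj; omega

lemma one_le_Pexp (k : ℕ) {s : ℝ} (hs : 1 ≤ s) : 1 ≤ Pexp k s := by
  unfold Pexp
  exact Finset.prod_induction (fun j => Real.exp^[k - j] s) (fun x => 1 ≤ x)
    (fun a b ha hb => one_le_mul_of_one_le_of_one_le ha hb) le_rfl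
    (fun j _ => hs.trans (le_exp_iter _ _))

lemma Pexp_continuous (k : ℕ) : Continuous (Pexp k) :=
  continuous_finsetProd _ fun j _ => (exp_iter_contDiff (k - j)).continuous

lemma exp_iter_hasDerivAt' (k : ℕ) (s : ℝ) :
    HasDerivAt (Real.exp^[k]) (∏ i ∈ Finset.range k, Real.exp^[i + 1] s) s := by
  induction k with
  | zero => simpa using hasDerivAt_id s
  | succ k ih =>
    rw [Function.iterate_succ', Finset.prod_range_succ, mul_comm]
    have := (Real.hasDerivAt_exp (Real.exp^[k] s)).comp s ih
    rw [Function.iterate_succ_apply' Real.exp k s]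
    exact this

lemma exp_iter_hasDerivAt {k : ℕ} (hk : 1 ≤ k) (s : ℝ) :
    HasDerivAt (Real.exp^[k]) (Pexp k s * Real.exp^[k] s) s := by
  convert exp_iter_hasDerivAt' k s using 1
  obtain ⟨i, rfl⟩ := Nat.exists_eq_add_of_le' hk
  rw [Finset.prod_range_succ]
  congr 1
  unfold Pexp
  rw [Finset.prod_Ico_eq_prod_range, ← Finset.prod_range_reflect]
  refine Finset.prod_congr (by simp) fun j hj => ?_
  simp at hj
  congr 2
  simp
  omega

lemma exists_exp_iter (k : ℕ) : ∀ {c z : ℝ}, Real.exp^[k] c < z → ∃ s, c < s ∧ Real.exp^[k] s = z := by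
  induction k with
  | zero => intro c z h; exact ⟨z, h, rfl⟩
  | succ k ih =>
    intro c z h
    rw [Function.iterate_succ_apply'] at h
    have hz : 0 < z := (Real.exp_pos _).trans h
    obtain ⟨s, hs, h2⟩ := ih ((Real.lt_log_iff_exp_lt hz).2 h)
    exact ⟨s, hs, by rw [Function.iterate_succ_apply', h2, Real.exp_log hz]⟩

/-- radial factor -/
noncomputable def afac (k : ℕ) (B ρ : ℝ) : ℝ := B / Real.exp^[k] ρ⁻¹ / ρ

lemma afac_pos {k : ℕ} (hk : 1 ≤ k) {B ρ : ℝ} (hB : 0 < B) (hρ : 0 < ρ) : 0 < afac k B ρ := by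
  have := exp_iter_pos hk ρ⁻¹
  unfold afac; positivity

lemma afac_hasDerivAt {k : ℕ} (hk : 1 ≤ k) (B : ℝ) {ρ : ℝ} (hρ : 0 < ρ) :
    HasDerivAt (afac k B) (afac k B ρ * (Pexp k ρ⁻¹ * ρ⁻¹ - 1) / ρ) ρ := by
  have h0 := (exp_iter_pos hk ρ⁻¹)
  have h1 := (exp_iter_hasDerivAt hk ρ⁻¹).comp ρ (hasDerivAt_inv hρ.ne')
  have h2 := ((hasDerivAt_const ρ B).div h1 h0.ne').div (hasDerivAt_id ρ) hρ.ne'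
  have h3 : HasDerivAt (afac k B) _ ρ := h2
  convert h3 using 1
  simp [afac]
  field_simp

/-- radial diffeomorphism -/
noncomputable def Psi {n : ℕ} (k : ℕ) (B : ℝ) (y : EuclideanSpace ℝ (Fin n)) :
    EuclideanSpace ℝ (Fin n) := afac k B ‖y‖ • y

noncomputable def DPsi {n : ℕ} (k : ℕ) (B : ℝ) (y : EuclideanSpace ℝ (Fin n)) :
    EuclideanSpace ℝ (Fin n) →L[ℝ] EuclideanSpace ℝ (Fin n) :=
  afac k B ‖y‖ • (ContinuousLinearMap.id ℝ _ +
    (((Pexp k ‖y‖⁻¹ * ‖y‖⁻¹ - 1) / ‖y‖ ^ 2) • innerSL ℝ y).smulRight y)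

section
variable {n k : ℕ} {B : ℝ} {y : EuclideanSpace ℝ (Fin n)}

lemma norm_Psi (hk : 1 ≤ k) (hB : 0 < B) (hy : y ≠ 0) :
    ‖Psi k B y‖ = B / Real.exp^[k] ‖y‖⁻¹ := by
  have hy' : 0 < ‖y‖ := norm_pos_iff.2 hy
  rw [Psi, norm_smul, Real.norm_of_nonneg (afac_pos hk hB hy').le, afac]
  field_simp

lemma afac_hasFDerivAt (hk : 1 ≤ k) (hy : y ≠ 0) :
    HasFDerivAt (fun y : EuclideanSpace ℝ (Fin n) => afac k B ‖y‖)
      ((afac k B ‖y‖ * (Pexp k ‖y‖⁻¹ * ‖y‖⁻¹ - 1) / ‖y‖) • (‖y‖⁻¹ • innerSL ℝ y)) y :=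
  (afac_hasDerivAt hk B (norm_pos_iff.2 hy)).comp_hasFDerivAt y (hasFDerivAt_norm_aux hy)

lemma Psi_hasFDerivAt (hk : 1 ≤ k) (hy : y ≠ 0) :
    HasFDerivAt (Psi k B) (DPsi k B y) y := by
  have h := (afac_hasFDerivAt (B := B) hk hy).smul (hasFDerivAt_id y)
  refine HasFDerivAt.congr_fderiv (f := Psi k B) h ?_
  have hy' : 0 < ‖y‖ := norm_pos_iff.2 hy
  ext1 z
  simp only [DPsi, add_apply, smul_apply, ContinuousLinearMap.smulRight_apply,
    ContinuousLinearMap.id_apply, smul_add, id]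
  congr 1
  simp only [smul_smul, smul_eq_mul]
  congr 1
  field_simp

lemma det_DPsi (hy : y ≠ 0) :
    (DPsi k B y).det = afac k B ‖y‖ ^ n * (Pexp k ‖y‖⁻¹ * ‖y‖⁻¹) := by
  have hy' : 0 < ‖y‖ := norm_pos_iff.2 hy
  have e : ((DPsi k B y : EuclideanSpace ℝ (Fin n) →L[ℝ] EuclideanSpace ℝ (Fin n)) :
      EuclideanSpace ℝ (Fin n) →ₗ[ℝ] EuclideanSpace ℝ (Fin n)) =
      afac k B ‖y‖ • LinearMap.transvection
        ((((Pexp k ‖y‖⁻¹ * ‖y‖⁻¹ - 1) / ‖y‖ ^ 2) • innerSL ℝ y : EuclideanSpace ℝ (Fin n) →L[ℝ] ℝ) :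
          EuclideanSpace ℝ (Fin n) →ₗ[ℝ] ℝ) y := by
    ext1 z
    simp [DPsi, LinearMap.transvection.apply]
  rw [ContinuousLinearMap.det, e, LinearMap.det_smul, LinearMap.transvection.det]
  simp only [finrank_euclideanSpace, Fintype.card_fin]
  congr 1
  simp
  field_simp
  ring

lemma norm_DPsi_le (hk : 1 ≤ k) (hB : 0 < B) (hy : y ≠ 0) (hc : 1 ≤ Pexp k ‖y‖⁻¹ * ‖y‖⁻¹) :
    ‖DPsi k B y‖ ≤ afac k B ‖y‖ * (Pexp k ‖y‖⁻¹ * ‖y‖⁻¹) := by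
  have hy' : 0 < ‖y‖ := norm_pos_iff.2 hy
  have ha := afac_pos hk hB hy'
  rw [DPsi, norm_smul, Real.norm_of_nonneg ha.le]
  gcongr
  refine (norm_add_le _ _).trans ?_
  rw [ContinuousLinearMap.norm_smulRight_apply, norm_smul, innerSL_apply_norm,
    Real.norm_of_nonneg (div_nonneg (by linarith) (by positivity))]
  have h1 : ‖ContinuousLinearMap.id ℝ (EuclideanSpace ℝ (Fin n))‖ ≤ 1 :=
    ContinuousLinearMap.norm_id_le
  have h2 : (Pexp k ‖y‖⁻¹ * ‖y‖⁻¹ - 1) / ‖y‖ ^ 2 * ‖y‖ * ‖y‖ = Pexp k ‖y‖⁻¹ * ‖y‖⁻¹ - 1 := by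
    field_simp
  rw [h2]; linarith

lemma Psi_contDiffAt (hk : 1 ≤ k) (hy : y ≠ 0) : ContDiffAt ℝ 1 (Psi k B) y := by
  have h1 : ContDiffAt ℝ 1 (fun y : EuclideanSpace ℝ (Fin n) => ‖y‖) y := contDiffAt_norm ℝ hy
  have hn : ‖y‖ ≠ 0 := norm_ne_zero_iff.2 hy
  have h2 : ContDiffAt ℝ 1 (fun y : EuclideanSpace ℝ (Fin n) => Real.exp^[k] ‖y‖⁻¹) y :=
    (exp_iter_contDiff k).contDiffAt.comp y (h1.inv hn)
  exact ((contDiffAt_const.div h2 (exp_iter_pos hk _).ne').div h1 hn).smul contDiffAt_id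

lemma Psi_injOn (hk : 1 ≤ k) (hB : 0 < B) : InjOn (Psi (n := n) k B) {y | y ≠ 0} := by
  intro y hy z hz h
  have hy' : 0 < ‖y‖ := norm_pos_iff.2 hy
  have hz' : 0 < ‖z‖ := norm_pos_iff.2 hz
  have h1 : ‖Psi k B y‖ = ‖Psi k B z‖ := by rw [h]
  rw [norm_Psi hk hB hy, norm_Psi hk hB hz] at h1
  have h2 : Real.exp^[k] ‖y‖⁻¹ = Real.exp^[k] ‖z‖⁻¹ := by
    have a1 := exp_iter_pos hk ‖y‖⁻¹
    have a2 := exp_iter_pos hk ‖z‖⁻¹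
    rw [div_eq_div_iff a1.ne' a2.ne'] at h1
    exact (mul_left_cancel₀ hB.ne' h1).symm
  have h3 : ‖y‖ = ‖z‖ := inv_injective ((exp_iter_strictMono k).injective h2)
  rw [Psi, Psi, h3] at h
  exact smul_right_injective _ (afac_pos hk hB hz').ne' h

end

lemma Psi_image {n k : ℕ} (hk : 1 ≤ k) {R η : ℝ} (hη : 0 < η) (hR : Real.exp^[k + 1] 1 < R) :
    Psi (n := n) k (R * η) '' {y | y ≠ 0 ∧ R < Real.exp^[k] ‖y‖⁻¹} = Metric.ball 0 η \ {0} := by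
  have hR0 : 0 < R := (exp_iter_pos (by omega) _).trans hR
  have hB : 0 < R * η := by positivity
  ext x
  constructor
  · rintro ⟨y, ⟨hy, hyR⟩, rfl⟩
    have hpos := exp_iter_pos hk ‖y‖⁻¹
    have hn := norm_Psi (n := n) hk hB hy
    constructor
    · rw [mem_ball_zero_iff, hn, div_lt_iff₀ hpos, mul_comm]
      gcongr
    · rw [mem_singleton_iff, ← norm_eq_zero, hn]; positivity
  · rintro ⟨hx, hx0⟩
    rw [mem_ball_zero_iff] at hx
    have hx0 : x ≠ 0 := hx0
    have hx' : 0 < ‖x‖ := norm_pos_iff.2 hx0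
    have hRz : R < R * η / ‖x‖ := by rw [lt_div_iff₀ hx']; gcongr
    rw [Function.iterate_succ_apply] at hR
    obtain ⟨s, hs, hsz⟩ := exists_exp_iter k (hR.trans hRz)
    have hs0 : 0 < s := (Real.exp_pos 1).trans hs
    have hn : ‖(s⁻¹ / ‖x‖) • x‖ = s⁻¹ := by
      rw [norm_smul, Real.norm_of_nonneg (by positivity)]; field_simp
    refine ⟨(s⁻¹ / ‖x‖) • x, ⟨?_, ?_⟩, ?_⟩
    · rw [← norm_ne_zero_iff, hn]; positivity
    · rw [hn, inv_inv, hsz]; exact hRz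
    · rw [Psi, hn, afac, inv_inv, hsz, smul_smul]
      have : R * η / (R * η / ‖x‖) / s⁻¹ * (s⁻¹ / ‖x‖) = 1 := by field_simp
      rw [this, one_smul]

lemma weight_id1 (n : ℕ) {t P ρ α p q U : ℝ} (ht : 0 < t) (hP : 0 < P) (hρ : 0 < ρ) (hp : 1 < p) :
    ((t / ρ) ^ n * (P * ρ⁻¹)) * (U * t ^ (1 - (n:ℝ)) /
      ((t * P * ρ⁻¹ ^ α) * ρ⁻¹ ^ ((1 - α) * (1 + q / (p / (p - 1)))))) =
    U * ρ ^ ((1 - α) / (p / (p - 1)) * q - n) := by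
  rw [← Real.exp_log ht, ← Real.exp_log hP, ← Real.exp_log hρ]
  generalize Real.log t = a
  generalize Real.log P = b
  generalize Real.log ρ = c
  rw [← Real.rpow_natCast]
  simp only [← Real.exp_mul, ← Real.exp_add, ← Real.exp_neg, ← Real.exp_sub]
  rw [mul_div_assoc, mul_left_comm]
  simp only [← Real.exp_mul, ← Real.exp_add, ← Real.exp_neg, ← Real.exp_sub]
  congr 2
  have : p - 1 ≠ 0 := by linarith
  field_simp
  ring

lemma weight_id2 (n : ℕ) {t P ρ α p U : ℝ} (ht : 0 < t) (hP : 0 < P) (hρ : 0 < ρ) :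
    ((t / ρ) ^ n * (P * ρ⁻¹)) * (U * (t * P * ρ⁻¹ ^ α) ^ (p - 1) * t ^ (1 - (n:ℝ))) =
    U * (t * P) ^ p * ρ ^ (-α * (p - 1) - 1 - n) := by
  rw [← Real.exp_log ht, ← Real.exp_log hP, ← Real.exp_log hρ]
  generalize Real.log t = a
  generalize Real.log P = b
  generalize Real.log ρ = c
  rw [← Real.rpow_natCast]
  simp only [← Real.exp_mul, ← Real.exp_add, ← Real.exp_neg, ← Real.exp_sub]
  rw [mul_assoc U, mul_assoc U, mul_left_comm]
  simp only [← Real.exp_mul, ← Real.exp_add, ← Real.exp_neg, ← Real.exp_sub]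
  congr 2
  ring

lemma weight_id3 (n : ℕ) {t P ρ α p U : ℝ} (ht : 0 < t) (hP : 0 < P) (hρ : 0 < ρ) (hp : 1 < p)
    (hU : 0 ≤ U) :
    (U * (t / ρ * (P * ρ⁻¹))) ^ p * ρ ^ (((1 - α) / (p / (p - 1)) + 1) * p - n) =
    U ^ p * (t * P) ^ p * ρ ^ (-α * (p - 1) - 1 - n) := by
  rw [Real.mul_rpow hU (by positivity)]
  rw [← Real.exp_log ht, ← Real.exp_log hP, ← Real.exp_log hρ]
  generalize Real.log t = a
  generalize Real.log P = b
  generalize Real.log ρ = c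
  rw [mul_assoc, mul_assoc]
  simp only [← Real.exp_mul, ← Real.exp_add, ← Real.exp_neg, ← Real.exp_sub]
  congr 2
  have : p - 1 ≠ 0 := by linarith
  field_simp
  ring


lemma cov_aux {n k : ℕ} (hn : 1 ≤ n) (hk : 1 ≤ k) {R η : ℝ} (hη : 0 < η)
    (hR : Real.exp^[k + 1] 1 < R) (f : EuclideanSpace ℝ (Fin n) → ℝ) :
    ∫ x in Metric.ball (0 : EuclideanSpace ℝ (Fin n)) η, f x =
      ∫ y in {y : EuclideanSpace ℝ (Fin n) | y ≠ 0 ∧ R < Real.exp^[k] ‖y‖⁻¹},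
        (afac k (R * η) ‖y‖ ^ n * (Pexp k ‖y‖⁻¹ * ‖y‖⁻¹)) * f (Psi k (R * η) y) := by
  have hR0 : 0 < R := (exp_iter_pos (by omega) _).trans hR
  have hB : 0 < R * η := by positivity
  have : Nonempty (Fin n) := ⟨⟨0, hn⟩⟩
  set S : Set (EuclideanSpace ℝ (Fin n)) := {y | y ≠ 0 ∧ R < Real.exp^[k] ‖y‖⁻¹} with hS
  have hSm : MeasurableSet S := by
    refine MeasurableSet.inter (measurableSet_singleton (0 : EuclideanSpace ℝ (Fin n))).compl ?_
    exact measurableSet_lt measurable_const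
      ((exp_iter_contDiff k).continuous.measurable.comp measurable_norm.inv)
  have e1 : ∫ x in Metric.ball (0 : EuclideanSpace ℝ (Fin n)) η, f x =
      ∫ x in Metric.ball (0 : EuclideanSpace ℝ (Fin n)) η \ {0}, f x := by
    refine setIntegral_congr_set ?_
    exact (sdiff_null_ae_eq_self (measure_singleton _)).symm
  rw [e1, ← Psi_image hk hη hR, integral_image_eq_integral_abs_det_fderiv_smul volume hSm
    (fun y hy => (Psi_hasFDerivAt hk hy.1).hasFDerivWithinAt)
    ((Psi_injOn hk hB).mono fun y hy => hy.1)]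
  refine setIntegral_congr_fun hSm fun y hy => ?_
  have hy' : 0 < ‖y‖ := norm_pos_iff.2 hy.1
  have ha := afac_pos hk hB hy'
  have hP := Pexp_pos k ‖y‖⁻¹
  simp only [smul_eq_mul]
  rw [det_DPsi hy.1, abs_of_pos (by positivity)]

/-- Critical CKN-type inequality with poly-logarithmic weights, non-critical exponent
`α ≠ 1`: for `n, k ≥ 1`, `1 < p ≤ q < ∞` with `0 ≤ 1/p − 1/q ≤ 1/n`, `η > 0` and
`R > exp^{k+1}(1)`, there is `C > 0` such that for all `u ∈ C_c^∞(B_η∖{0})`,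
`∫_{B_η} |∇u|^p w_{k,α}(|x|)^{p−1} |x|^{1−n} ≥
 C·|α−1|^{p−1+p/q} (∫_{B_η} |u|^q |x|^{1−n} / (w_{k,α}(|x|)·(log^k(Rη/|x|))^{(1−α)(1+q/p')}))^{p/q}`. -/
theorem stmt14 (n k : ℕ) (hn : 1 ≤ n) (hk : 1 ≤ k) (p q : ℝ) (hp : 1 < p) (hpq : p ≤ q)
    (h1 : 0 ≤ 1 / p - 1 / q) (h2 : 1 / p - 1 / q ≤ 1 / (n : ℝ))
    (η : ℝ) (hη : 0 < η) (α : ℝ) (hα : α ≠ 1)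
    (R : ℝ) (hR : Real.exp^[k + 1] 1 < R) :
    ∃ C : ℝ, 0 < C ∧ ∀ u : EuclideanSpace ℝ (Fin n) → ℝ,
      ContDiff ℝ (⊤ : ℕ∞) u → HasCompactSupport u →
      tsupport u ⊆ Metric.ball 0 η \ {0} →
      ∫ x in Metric.ball (0 : EuclideanSpace ℝ (Fin n)) η,
          ‖fderiv ℝ u x‖ ^ p * (wlog k α R η ‖x‖) ^ (p - 1) * ‖x‖ ^ (1 - (n : ℝ)) ≥
        C * |α - 1| ^ (p - 1 + p / q) *
          (∫ x in Metric.ball (0 : EuclideanSpace ℝ (Fin n)) η,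
            |u x| ^ q * ‖x‖ ^ (1 - (n : ℝ)) /
              (wlog k α R η ‖x‖ *
                (Real.log^[k] (R * η / ‖x‖)) ^
                  ((1 - α) * (1 + q / (p / (p - 1)))))) ^ (p / q) := by
  have hR0 : 0 < R := (exp_iter_pos (by omega) _).trans hR
  have hB : 0 < R * η := by positivity
  have hp0 : 0 < p := by linarith
  have hp1 : 0 < p - 1 := by linarith
  have hβ : (1 - α) / (p / (p - 1)) ≠ 0 :=
    div_ne_zero (sub_ne_zero.2 hα.symm) (by positivity)
  obtain ⟨C, hC, hckn⟩ := ckn_aux n hn p q hp hpq h2 _ hβ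
  have hA : 0 < |α - 1| ^ (p - 1 + p / q) :=
    Real.rpow_pos_of_pos (abs_pos.2 (sub_ne_zero.2 hα)) _
  refine ⟨(C * |α - 1| ^ (p - 1 + p / q))⁻¹, by positivity, fun u hu huc hus => ?_⟩
  have hu1 : ContDiff ℝ 1 u := hu.of_le (by exact_mod_cast le_top)
  have h0K : (0 : EuclideanSpace ℝ (Fin n)) ∈ (tsupport u)ᶜ := fun h => (hus h).2 rfl
  obtain ⟨δ', hδ', hball⟩ :=
    Metric.isOpen_iff.1 (isClosed_tsupport u).isOpen_compl 0 h0K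
  have hKmem : ∀ y : EuclideanSpace ℝ (Fin n), Psi k (R * η) y ∈ tsupport u →
      y ≠ 0 ∧ R < Real.exp^[k] ‖y‖⁻¹ ∧ 1 ≤ ‖y‖⁻¹ ∧ δ' / (R * η) ≤ ‖y‖ ∧ ‖y‖ ≤ 1 := by
    intro y hy
    have hy0 : y ≠ 0 := by
      rintro rfl
      apply h0K
      simpa [Psi] using hy
    have hy' : 0 < ‖y‖ := norm_pos_iff.2 hy0
    have hE := exp_iter_pos hk ‖y‖⁻¹
    have hnorm := norm_Psi hk hB hy0
    have hlt : ‖Psi k (R * η) y‖ < η := by simpa using (hus hy).1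
    have hge : δ' ≤ ‖Psi k (R * η) y‖ := by
      by_contra hcon
      exact hball (by simpa using hcon) hy
    rw [hnorm] at hlt hge
    have hRE : R < Real.exp^[k] ‖y‖⁻¹ := by
      rw [div_lt_iff₀ hE, mul_comm] at hlt
      exact lt_of_mul_lt_mul_left hlt hη.le
    have hinv : 1 ≤ ‖y‖⁻¹ := by
      have h3 := hR.trans hRE
      rw [Function.iterate_succ_apply] at h3
      have h4 := (exp_iter_strictMono k).lt_iff_lt.1 h3
      linarith [Real.add_one_le_exp (1 : ℝ)]
    refine ⟨hy0, hRE, hinv, ?_, ?_⟩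
    · rw [le_div_iff₀ hE] at hge
      have h5 : δ' * ‖y‖⁻¹ ≤ R * η :=
        (mul_le_mul_of_nonneg_left (le_exp_iter k _) hδ'.le).trans hge
      rw [div_le_iff₀ hB]
      rw [← div_eq_mul_inv, div_le_iff₀ hy'] at h5
      linarith
    · exact (one_le_inv₀ hy').1 hinv
  have hδ : 0 < δ' / (R * η) := by positivity
  set v : EuclideanSpace ℝ (Fin n) → ℝ := fun y => u (Psi k (R * η) y) with hv
  have hvz : ∀ y, ¬(δ' / (R * η) ≤ ‖y‖ ∧ ‖y‖ ≤ 1) → v y = 0 := fun y hy =>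
    image_eq_zero_of_notMem_tsupport (f := u) fun h => hy (hKmem y h).2.2.2
  have hvc : ContDiff ℝ 1 v := by
    rw [contDiff_iff_contDiffAt]
    intro y
    by_cases hy : y = 0
    · have : v =ᶠ[𝓝 y] fun _ => 0 := by
        filter_upwards [Metric.ball_mem_nhds y hδ] with z hz'
        refine hvz z fun h => ?_
        rw [hy] at hz'
        have : ‖z‖ < δ' / (R * η) := by simpa using hz'
        linarith [h.1]
      exact contDiffAt_const.congr_of_eventuallyEq this
    · exact hu1.contDiffAt.comp y (Psi_contDiffAt hk hy)
  have hmain := hckn v _ _ hvc hδ hvz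
  -- facts about the weight
  have hT : ∀ y : EuclideanSpace ℝ (Fin n), y ≠ 0 → 0 < ‖Psi k (R * η) y‖ := by
    intro y hy
    have hE := exp_iter_pos hk ‖y‖⁻¹
    rw [norm_Psi hk hB hy]; positivity
  have hq1 : ∀ y : EuclideanSpace ℝ (Fin n), y ≠ 0 →
      R * η / ‖Psi k (R * η) y‖ = Real.exp^[k] ‖y‖⁻¹ := by
    intro y hy
    have hE := exp_iter_pos hk ‖y‖⁻¹
    rw [norm_Psi hk hB hy]; field_simp
  have hw : ∀ y : EuclideanSpace ℝ (Fin n), y ≠ 0 → wlog k α R η ‖Psi k (R * η) y‖ =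
      ‖Psi k (R * η) y‖ * Pexp k ‖y‖⁻¹ * ‖y‖⁻¹ ^ α := by
    intro y hy
    rw [wlog, hq1 y hy, log_iter_exp_iter le_rfl, Nat.sub_self, Function.iterate_zero, id, Pexp]
    congr 2
    refine Finset.prod_congr rfl fun j hj => ?_
    rw [log_iter_exp_iter (Finset.mem_Ico.1 hj).2.le]
  have haf : ∀ y : EuclideanSpace ℝ (Fin n), y ≠ 0 →
      afac k (R * η) ‖y‖ = ‖Psi k (R * η) y‖ / ‖y‖ := by
    intro y hy
    rw [norm_Psi hk hB hy, afac]
  set S : Set (EuclideanSpace ℝ (Fin n)) := {y | y ≠ 0 ∧ R < Real.exp^[k] ‖y‖⁻¹} with hS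
  have hSm : MeasurableSet S := by
    refine MeasurableSet.inter (measurableSet_singleton (0 : EuclideanSpace ℝ (Fin n))).compl ?_
    exact measurableSet_lt measurable_const
      ((exp_iter_contDiff k).continuous.measurable.comp measurable_norm.inv)
  -- right-hand integral
  have hrhs : ∫ x in Metric.ball (0 : EuclideanSpace ℝ (Fin n)) η,
            |u x| ^ q * ‖x‖ ^ (1 - (n : ℝ)) /
              (wlog k α R η ‖x‖ *
                (Real.log^[k] (R * η / ‖x‖)) ^
                  ((1 - α) * (1 + q / (p / (p - 1))))) =
      ∫ y, ‖v y‖ ^ q * ‖y‖ ^ ((1 - α) / (p / (p - 1)) * q - n) := by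
    rw [cov_aux hn hk hη hR]
    rw [← setIntegral_eq_integral_of_forall_compl_eq_zero (s := S) (μ := volume)
      (f := fun y => ‖v y‖ ^ q * ‖y‖ ^ ((1 - α) / (p / (p - 1)) * q - n))]
    · refine setIntegral_congr_fun hSm fun y hy => ?_
      have hy' : 0 < ‖y‖ := norm_pos_iff.2 hy.1
      rw [hw y hy.1, hq1 y hy.1, log_iter_exp_iter le_rfl, Nat.sub_self, Function.iterate_zero, id,
        haf y hy.1, weight_id1 n (hT y hy.1) (Pexp_pos k _) hy' hp]
      rfl
    · intro y hy
      have : v y = 0 := image_eq_zero_of_notMem_tsupport (f := u)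
        fun h => hy ⟨(hKmem y h).1, (hKmem y h).2.1⟩
      rw [this, norm_zero, Real.zero_rpow (by linarith), zero_mul]
  -- left-hand integral
  set H : EuclideanSpace ℝ (Fin n) → ℝ := fun y =>
    ‖fderiv ℝ u (Psi k (R * η) y)‖ ^ p * (‖Psi k (R * η) y‖ * Pexp k ‖y‖⁻¹) ^ p *
      ‖y‖ ^ (-α * (p - 1) - 1 - n) with hH
  have hfz : ∀ x, x ∉ tsupport u → fderiv ℝ u x = 0 := fun x hx =>
    image_eq_zero_of_notMem_tsupport fun h => hx (tsupport_fderiv_subset ℝ h)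
  have hHz : ∀ y, Psi k (R * η) y ∉ tsupport u → H y = 0 := by
    intro y hy
    simp only [hH]
    rw [hfz _ hy, norm_zero, Real.zero_rpow hp0.ne', zero_mul, zero_mul]
  have hlhs : ∫ x in Metric.ball (0 : EuclideanSpace ℝ (Fin n)) η,
          ‖fderiv ℝ u x‖ ^ p * (wlog k α R η ‖x‖) ^ (p - 1) * ‖x‖ ^ (1 - (n : ℝ)) =
      ∫ y, H y := by
    rw [cov_aux hn hk hη hR]
    rw [← setIntegral_eq_integral_of_forall_compl_eq_zero (s := S) (μ := volume) (f := H)]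
    · refine setIntegral_congr_fun hSm fun y hy => ?_
      have hy' : 0 < ‖y‖ := norm_pos_iff.2 hy.1
      rw [hw y hy.1, haf y hy.1, weight_id2 n (hT y hy.1) (Pexp_pos k _) hy']
    · intro y hy
      exact hHz y fun h => hy ⟨(hKmem y h).1, (hKmem y h).2.1⟩
  have hHi : Integrable H := by
    refine integ_aux (M := 1) hδ ?_ fun y hy => hHz y fun h => hy (hKmem y h).2.2.2
    have c1 : ContinuousOn (Psi (n := n) k (R * η)) {y | y ≠ 0} := fun y hy =>
      (Psi_contDiffAt hk hy).continuousAt.continuousWithinAt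
    have c2 : ContinuousOn (fun y : EuclideanSpace ℝ (Fin n) => Pexp k ‖y‖⁻¹) {y | y ≠ 0} :=
      (Pexp_continuous k).comp_continuousOn
        (continuous_norm.continuousOn.inv₀ fun y hy => norm_ne_zero_iff.2 hy)
    refine ContinuousOn.mul (ContinuousOn.mul ?_ ?_) (npos_aux _)
    · exact (((hu1.continuous_fderiv one_ne_zero).comp_continuousOn c1).norm).rpow_const
        fun _ _ => Or.inr hp0.le
    · exact (c1.norm.mul c2).rpow_const fun _ _ => Or.inr hp0.le
  have hle : ∫ y, ‖fderiv ℝ v y‖ ^ p * ‖y‖ ^ (((1 - α) / (p / (p - 1)) + 1) * p - n) ≤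
      ∫ y, H y := by
    refine integral_mono_of_nonneg (Eventually.of_forall fun y => by positivity) hHi
      (Eventually.of_forall fun y => ?_)
    simp only
    by_cases hy : Psi k (R * η) y ∈ tsupport u
    · obtain ⟨hy0, -, hinv, -⟩ := hKmem y hy
      have hy' : 0 < ‖y‖ := norm_pos_iff.2 hy0
      have hD : HasFDerivAt v ((fderiv ℝ u (Psi k (R * η) y)).comp (DPsi k (R * η) y)) y :=
        ((hu1.differentiable one_ne_zero _).hasFDerivAt).comp y (Psi_hasFDerivAt hk hy0)
      have hb : ‖fderiv ℝ v y‖ ≤ ‖fderiv ℝ u (Psi k (R * η) y)‖ *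
          (‖Psi k (R * η) y‖ / ‖y‖ * (Pexp k ‖y‖⁻¹ * ‖y‖⁻¹)) := by
        rw [hD.fderiv, ← haf y hy0]
        refine (ContinuousLinearMap.opNorm_comp_le _ _).trans ?_
        gcongr
        exact norm_DPsi_le hk hB hy0 (one_le_mul_of_one_le_of_one_le (one_le_Pexp k hinv) hinv)
      simp only [hH]
      rw [← weight_id3 n (hT y hy0) (Pexp_pos k _) hy' hp (norm_nonneg _)]
      gcongr
    · rw [hHz y hy]
      refine le_of_eq ?_
      by_cases hy0 : y = 0
      · rw [fderiv_zero_of_annulus hvz y (hy0 ▸ not_annulus_zero hδ), norm_zero,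
          Real.zero_rpow hp0.ne', zero_mul]
      · have hD : HasFDerivAt v ((fderiv ℝ u (Psi k (R * η) y)).comp (DPsi k (R * η) y)) y :=
          ((hu1.differentiable one_ne_zero _).hasFDerivAt).comp y (Psi_hasFDerivAt hk hy0)
        rw [hD.fderiv, hfz _ hy, ContinuousLinearMap.zero_comp, norm_zero,
          Real.zero_rpow hp0.ne', zero_mul]
  rw [hrhs, hlhs, ge_iff_le]
  have hfin := hmain.trans (mul_le_mul_of_nonneg_left hle hC.le)
  rw [mul_inv, inv_mul_cancel_right₀ hA.ne', inv_mul_le_iff₀ hC]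
  exact hfin
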